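/- Let u ∈ C_c^∞(ℝ²). Then ‖∇u‖_{L⁶(ℝ²)} ≤ √6 · ‖∇u‖_{L²(ℝ²)}^{1/2} · ‖∇²u‖_{L³(ℝ²)}^{1/2}, where ∇²u denotes the Hessian of u. -/

import Mathlib

open MeasureTheory

/-- Partial derivative in the `i`-th coordinate direction. -/
noncomputable def pd {n : ℕ} (i : Fin n) (f : EuclideanSpace ℝ (Fin n) → ℝ)
    (x : EuclideanSpace ℝ (Fin n)) : ℝ :=
  fderiv ℝ f x (EuclideanSpace.single i 1)

/-- Frobenius norm of the Hessian of `u`. -/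
noncomputable def hessFrob {n : ℕ} (u : EuclideanSpace ℝ (Fin n) → ℝ)
    (x : EuclideanSpace ℝ (Fin n)) : ℝ :=
  Real.sqrt (∑ i, ∑ j, (pd i (pd j u) x) ^ 2)

open Gradient

lemma gradient_apply_eq_pd {n : ℕ} (u : EuclideanSpace ℝ (Fin n) → ℝ)
    (x : EuclideanSpace ℝ (Fin n)) (j : Fin n) : (∇ u x) j = pd j u x := by
  have h := inner_gradient_left (𝕜 := ℝ) (f := u) (x := x) (y := EuclideanSpace.single j (1 : ℝ))
  rw [EuclideanSpace.inner_single_right] at h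
  simpa [pd] using h

lemma norm_gradient {E : Type*} [NormedAddCommGroup E] [InnerProductSpace ℝ E] [CompleteSpace E]
    (u : E → ℝ) (x : E) : ‖∇ u x‖ = ‖fderiv ℝ u x‖ := by
  simp [gradient]

lemma contDiff_pd {n : ℕ} {u : EuclideanSpace ℝ (Fin n) → ℝ}
    (hu : ContDiff ℝ (⊤ : ℕ∞) u) (j : Fin n) : ContDiff ℝ (⊤ : ℕ∞) (pd j u) :=
  (hu.fderiv_right (m := (⊤ : ℕ∞)) (by simp)).clm_apply contDiff_const

lemma contDiff_gradient {n : ℕ} {u : EuclideanSpace ℝ (Fin n) → ℝ}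
    (hu : ContDiff ℝ (⊤ : ℕ∞) u) : ContDiff ℝ (⊤ : ℕ∞) (∇ u) := by
  rw [contDiff_euclidean]
  intro j
  simpa only [gradient_apply_eq_pd] using contDiff_pd hu j

lemma HasCompactSupport.gradient {E : Type*} [NormedAddCommGroup E] [InnerProductSpace ℝ E]
    [CompleteSpace E] {u : E → ℝ} (hu : HasCompactSupport u) : HasCompactSupport (∇ u) :=
  (hu.fderiv (𝕜 := ℝ)).comp_left (g := (InnerProductSpace.toDual ℝ E).symm) (map_zero _)

lemma HasCompactSupport.pd {n : ℕ} {u : EuclideanSpace ℝ (Fin n) → ℝ}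
    (hu : HasCompactSupport u) (j : Fin n) : HasCompactSupport (pd j u) :=
  hu.fderiv_apply ℝ _

lemma continuous_hessFrob {n : ℕ} {u : EuclideanSpace ℝ (Fin n) → ℝ}
    (hu : ContDiff ℝ (⊤ : ℕ∞) u) : Continuous (hessFrob u) :=
  Real.continuous_sqrt.comp <| continuous_finsetSum _ fun i _ => continuous_finsetSum _ fun j _ =>
    (contDiff_pd (contDiff_pd hu j) i).continuous.pow 2

lemma HasCompactSupport.hessFrob {n : ℕ} {u : EuclideanSpace ℝ (Fin n) → ℝ}
    (hu : HasCompactSupport u) : HasCompactSupport (hessFrob u) := by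
  refine hu.mono' fun x hx => ?_
  by_contra hxu
  refine hx ?_
  have h (i j : Fin n) : _root_.pd i (_root_.pd j u) x = 0 :=
    image_eq_zero_of_notMem_tsupport fun h =>
      hxu <| tsupport_fderiv_apply_subset ℝ _ <| tsupport_fderiv_apply_subset ℝ _ h
  simp [_root_.hessFrob, h]

lemma fderiv_apply_eq_sum_pd {n : ℕ} (f : EuclideanSpace ℝ (Fin n) → ℝ)
    (x h : EuclideanSpace ℝ (Fin n)) : fderiv ℝ f x h = ∑ i, h i * pd i f x := by
  conv_lhs => rw [← (EuclideanSpace.basisFun (Fin n) ℝ).sum_repr h]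
  simp [pd]

lemma norm_fderiv_gradient_le_hessFrob {n : ℕ} {u : EuclideanSpace ℝ (Fin n) → ℝ}
    (hu : ContDiff ℝ (⊤ : ℕ∞) u) (x : EuclideanSpace ℝ (Fin n)) :
    ‖fderiv ℝ (∇ u) x‖ ≤ hessFrob u x := by
  refine ContinuousLinearMap.opNorm_le_bound _ (Real.sqrt_nonneg _) fun h => ?_
  have hcoord (j : Fin n) : (fderiv ℝ (∇ u) x h) j = ∑ i, h i * pd i (pd j u) x := by
    have hd : HasFDerivAt (∇ u) (fderiv ℝ (∇ u) x) x :=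
      ((contDiff_gradient hu).differentiable (by simp) x).hasFDerivAt
    have hj := (((EuclideanSpace.proj (𝕜 := ℝ) j).hasFDerivAt).comp x hd).fderiv
    have hcomp : (EuclideanSpace.proj (𝕜 := ℝ) j) ∘ ∇ u = pd j u :=
      funext fun y => gradient_apply_eq_pd u y j
    rw [hcomp] at hj
    rw [← fderiv_apply_eq_sum_pd, hj]
    rfl
  rw [EuclideanSpace.norm_eq, EuclideanSpace.norm_eq, hessFrob,
    ← Real.sqrt_mul (Finset.sum_nonneg fun i _ => Finset.sum_nonneg fun j _ => sq_nonneg _)]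
  refine Real.sqrt_le_sqrt ?_
  simp only [Real.norm_eq_abs, sq_abs, hcoord]
  rw [Finset.sum_comm, Finset.sum_mul]
  refine Finset.sum_le_sum fun j _ => ?_
  rw [mul_comm]
  exact Finset.sum_mul_sq_le_sq_mul_sq _ _ _

lemma norm_equiv_symm_le_two :
    ‖((EuclideanSpace.equiv (Fin 2) ℝ).symm : (Fin 2 → ℝ) →L[ℝ] EuclideanSpace ℝ (Fin 2))‖ ≤ 2 := by
  refine ContinuousLinearMap.opNorm_le_bound _ zero_le_two fun h => ?_
  have h0 := norm_le_pi_norm h 0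
  have h1 := norm_le_pi_norm h 1
  rw [EuclideanSpace.norm_eq]
  refine Real.sqrt_le_iff.2 ⟨by positivity, ?_⟩
  simp only [Fin.sum_univ_two]
  change ‖h 0‖ ^ 2 + ‖h 1‖ ^ 2 ≤ _
  nlinarith [norm_nonneg (h 0), norm_nonneg (h 1), norm_nonneg h]

/-- A form of the Gagliardo-Nirenberg-Sobolev inequality in the plane. -/
lemma eLpNorm_two_le_two_mul_eLpNorm_fderiv_one {f : EuclideanSpace ℝ (Fin 2) → ℝ}
    (hf : ContDiff ℝ 1 f) (hfs : HasCompactSupport f) :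
    eLpNorm f 2 volume ≤ 2 * eLpNorm (fderiv ℝ f) 1 volume := by
  let e := (EuclideanSpace.equiv (Fin 2) ℝ).symm
  have he : MeasurePreserving e volume volume := PiLp.volume_preserving_toLp (Fin 2)
  have hconj : Real.HolderConjugate (Fintype.card (Fin 2)) 2 := by
    rw [Fintype.card_fin]
    exact_mod_cast Real.HolderConjugate.two_two
  have key := lintegral_pow_le_pow_lintegral_fderiv_aux hconj
    (hf.comp e.contDiff) (hfs.comp_homeomorph e.toHomeomorph)
  have hderiv (y : Fin 2 → ℝ) : ‖fderiv ℝ (f ∘ e) y‖ₑ ≤ 2 * ‖fderiv ℝ f (e y)‖ₑ := by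
    rw [e.comp_right_fderiv, mul_comm]
    refine (ContinuousLinearMap.opENorm_comp_le _ _).trans ?_
    gcongr
    rw [← ofReal_norm]
    simpa using ENNReal.ofReal_le_ofReal norm_equiv_symm_le_two
  have hcont : Continuous (fderiv ℝ f) := hf.continuous_fderiv one_ne_zero
  rw [← ENNReal.rpow_le_rpow_iff (z := 2) (by norm_num)]
  have hleft : eLpNorm f 2 volume ^ (2 : ℝ) = ∫⁻ y, ‖(f ∘ e) y‖ₑ ^ (2 : ℝ) := by
    rw [eLpNorm_eq_lintegral_rpow_enorm_toReal (by simp) (by simp), ← ENNReal.rpow_mul,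
      ← he.lintegral_comp (hf.continuous.enorm.measurable.pow_const _)]
    simp
  rw [hleft]
  refine key.trans ?_
  gcongr
  rw [eLpNorm_one_eq_lintegral_enorm, ← he.lintegral_comp hcont.enorm.measurable,
    ← lintegral_const_mul 2 (f := fun y => ‖fderiv ℝ f (e y)‖ₑ)
      (hcont.enorm.comp e.continuous).measurable]
  exact lintegral_mono hderiv

lemma eLpNorm_one_mul_mul_le {α : Type*} [MeasurableSpace α] {μ : Measure α} {g w : α → ℝ}
    (hg : AEStronglyMeasurable g μ) (hw : AEStronglyMeasurable w μ) :
    eLpNorm (g • (g • w)) 1 μ ≤ eLpNorm g 2 μ * (eLpNorm g 6 μ * eLpNorm w 3 μ) := by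
  have h2 : ENNReal.HolderTriple 2 2 1 := ⟨by simp [ENNReal.inv_two_add_inv_two]⟩
  have h6 : ENNReal.HolderTriple 6 3 2 := ⟨by
    rw [← ENNReal.toReal_eq_toReal_iff' (by simp) (by simp), ENNReal.toReal_add (by simp) (by simp)]
    norm_num⟩
  grw [eLpNorm_smul_le_mul_eLpNorm (p := 2) (q := 2) (hg.smul hw) hg,
    eLpNorm_smul_le_mul_eLpNorm (p := 6) (q := 3) hw hg]

theorem stmt4 (u : EuclideanSpace ℝ (Fin 2) → ℝ)
    (hu : ContDiff ℝ (⊤ : ℕ∞) u) (hsupp : HasCompactSupport u) :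
    (eLpNorm (fun x => ‖fderiv ℝ u x‖) 6 volume).toReal ≤
      Real.sqrt 6 * (eLpNorm (fun x => ‖fderiv ℝ u x‖) 2 volume).toReal ^ ((1 : ℝ) / 2) *
        (eLpNorm (hessFrob u) 3 volume).toReal ^ ((1 : ℝ) / 2) := by
  simp only [← norm_gradient]
  have hG : ContDiff ℝ 1 (∇ u) := (contDiff_gradient hu).of_le (by exact_mod_cast le_top)
  have hGs : HasCompactSupport (∇ u) := hsupp.gradient
  have hg : Continuous fun x => ‖∇ u x‖ := hG.continuous.norm
  have hW := continuous_hessFrob hu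
  have hsob := eLpNorm_two_le_two_mul_eLpNorm_fderiv_one
    (hG.norm_rpow (p := 3) (by norm_num))
    (hGs.comp_left (g := fun v => ‖v‖ ^ (3 : ℝ)) (by simp))
  have hpow : eLpNorm (fun x => ‖∇ u x‖ ^ (3 : ℝ)) 2 volume
      = eLpNorm (fun x => ‖∇ u x‖) 6 volume ^ (3 : ℝ) := by
    rw [eLpNorm_norm_rpow _ (by norm_num), eLpNorm_norm]
    congr 2
    norm_num
  have hderiv : eLpNorm (fderiv ℝ fun x => ‖∇ u x‖ ^ (3 : ℝ)) 1 volume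
      ≤ 3 * eLpNorm ((fun x => ‖∇ u x‖) • ((fun x => ‖∇ u x‖) • hessFrob u)) 1 volume := by
    have h3 : (3 : ENNReal) = ‖(3 : ℝ)‖ₑ := by simp [← ofReal_norm]
    rw [h3, ← eLpNorm_const_smul]
    refine eLpNorm_mono_real fun x => ?_
    refine (norm_fderiv_norm_rpow_le (hG.differentiable one_ne_zero) (by norm_num)).trans ?_
    grw [norm_fderiv_gradient_le_hessFrob hu x]
    norm_num [smul_eq_mul]
    exact le_of_eq (by ring)
  have hmain := hpow ▸ hsob.trans <| (mul_le_mul_right hderiv 2).trans <| mul_le_mul_right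
    (mul_le_mul_right (eLpNorm_one_mul_mul_le hg.aestronglyMeasurable hW.aestronglyMeasurable) 3) 2
  have hA (p : ENNReal) : eLpNorm (fun x => ‖∇ u x‖) p volume ≠ ⊤ :=
    (hg.memLp_of_hasCompactSupport hGs.norm).eLpNorm_ne_top
  have hC : eLpNorm (hessFrob u) 3 volume ≠ ⊤ :=
    (hW.memLp_of_hasCompactSupport hsupp.hessFrob).eLpNorm_ne_top
  have hreal := ENNReal.toReal_mono (by finiteness [hA 2, hA 6, hC]) hmain
  simp only [ENNReal.toReal_mul, ← ENNReal.toReal_rpow, ENNReal.toReal_ofNat] at hreal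
  set a := (eLpNorm (fun x => ‖∇ u x‖) 6 volume).toReal
  set b := (eLpNorm (fun x => ‖∇ u x‖) 2 volume).toReal
  set c := (eLpNorm (hessFrob u) 3 volume).toReal
  have ha : 0 ≤ a := ENNReal.toReal_nonneg
  have hb : 0 ≤ b := ENNReal.toReal_nonneg
  have hc : 0 ≤ c := ENNReal.toReal_nonneg
  rw [← Real.sqrt_eq_rpow, ← Real.sqrt_eq_rpow, ← Real.sqrt_mul (by norm_num),
    ← Real.sqrt_mul (by positivity)]
  refine Real.le_sqrt_of_sq_le ?_
  rcases ha.eq_or_lt with h0 | hpos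
  · rw [← h0, zero_pow two_ne_zero]
    positivity
  · refine le_of_mul_le_mul_right ?_ hpos
    have h3 : a ^ (3 : ℝ) = a ^ 3 := by exact_mod_cast Real.rpow_natCast a 3
    rw [h3] at hreal
    linarith
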